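/- arXiv:2509.04227 — 2 statements merged into one kernel-verified Lean document; each statement's English description precedes it below -/
import Mathlib

section
/- Let a ∈ {0,1}^ℕ start with digit 0, let b ∈ {0,1}^ℕ start with digit 1, and let q₀,q₁ > 1. If max π_{q₀,q₁}([0]_{a,b}) ≥ min π_{q₀,q₁}([1]_{a,b}), then π_{q₀,q₁}(Ω_{a,b}) = [0, 1/(q₁−1)]. -/
open Filter Topology

/-- The base corresponding to a digit: `q0` for digit `0` (`false`), `q1` for digit `1` (`true`). -/
noncomputable def qb (q0 q1 : ℝ) (d : Bool) : ℝ := if d then q1 else q0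

/-- `piE q0 q1 i = Σ_{k=1}^∞ i_k / (q_{i_1} ⋯ q_{i_k})`, with 0-based indexing. -/
noncomputable def piE (q0 q1 : ℝ) (i : ℕ → Bool) : ℝ :=
  ∑' k : ℕ, (if i k then (1 : ℝ) else 0) / ∏ j ∈ Finset.range (k + 1), qb q0 q1 (i j)

/-- Strict lexicographic order `≺` on binary sequences. -/
def lexLt (u v : ℕ → Bool) : Prop := ∃ n : ℕ, (∀ m, m < n → u m = v m) ∧ u n < v n

/-- Non-strict lexicographic order `⪯`. -/
def lexLe (u v : ℕ → Bool) : Prop := lexLt u v ∨ u = v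

/-- The tail `i_{n+1} i_{n+2} ⋯` of a sequence (0-based: drop the first `n` entries). -/
def shiftTail (i : ℕ → Bool) (n : ℕ) : ℕ → Bool := fun k => i (n + k)

/-- `Omega a b` : sequences none of whose tails lies in the open lexicographic interval `]a,b[`. -/
def Omega (a b : ℕ → Bool) : Set (ℕ → Bool) :=
  {i | ∀ n : ℕ, ¬ (lexLt a (shiftTail i n) ∧ lexLt (shiftTail i n) b)}

/-- `(a,b) ∈ W` : `a` starts with digit 0, `b` starts with digit 1, and `a, b ∈ Ω_{a,b}`. -/
def memW (a b : ℕ → Bool) : Prop :=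
  a 0 = false ∧ b 0 = true ∧ a ∈ Omega a b ∧ b ∈ Omega a b

/-- The set `L_{a,b,n}` of length-`n` prefixes of elements of `Ω_{a,b}`, as a finset. -/
noncomputable def Lwords (a b : ℕ → Bool) (n : ℕ) : Finset (Fin n → Bool) :=
  Set.Finite.toFinset
    (Set.toFinite {w : Fin n → Bool | ∃ i ∈ Omega a b, ∀ k : Fin n, i k.1 = w k})

/-- Topological entropy `h(Ω_{a,b}) = lim_{n→∞} (1/n) log #L_{a,b,n}`; the limit exists by
subadditivity, hence it coincides with the `limsup` used here. -/
noncomputable def entropy (a b : ℕ → Bool) : ℝ :=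
  Filter.limsup (fun n : ℕ => Real.log ((Lwords a b n).card) / n) Filter.atTop

/-- The cylinder `[d]_{a,b} = Ω_{a,b} ∩ d{0,1}^ℕ` of a single digit `d`. -/
def cyl (a b : ℕ → Bool) (d : Bool) : Set (ℕ → Bool) := {i | i ∈ Omega a b ∧ i 0 = d}

lemma aux_lexLt_trans {u v w : ℕ → Bool} (h1 : lexLt u v) (h2 : lexLt v w) : lexLt u w := by
  obtain ⟨n, hn, hn'⟩ := h1
  obtain ⟨m, hm, hm'⟩ := h2
  rcases lt_trichotomy n m with h | h | h
  · exact ⟨n, fun k hk => (hn k hk).trans (hm k (hk.trans h)), by rw [← hm n h]; exact hn'⟩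
  · subst h
    exact ⟨n, fun k hk => (hn k hk).trans (hm k hk), hn'.trans hm'⟩
  · exact ⟨m, fun k hk => (hn k (hk.trans h)).trans (hm k hk), by rw [hn m h]; exact hm'⟩

lemma aux_lexLt_tri (u v : ℕ → Bool) : lexLt u v ∨ u = v ∨ lexLt v u := by
  classical
  by_cases h : ∃ n, u n ≠ v n
  · have h1 := Nat.find_spec h
    have h2 : ∀ m, m < Nat.find h → u m = v m := fun m hm => by
      have := Nat.find_min h hm
      simpa using this
    rcases lt_or_gt_of_ne h1 with h3 | h3
    · exact Or.inl ⟨_, h2, h3⟩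
    · exact Or.inr (Or.inr ⟨_, fun m hm => (h2 m hm).symm, h3⟩)
  · push Not at h
    exact Or.inr (Or.inl (funext h))

lemma aux_isOpen_eval (n : ℕ) (S : Set Bool) : IsOpen {u : ℕ → Bool | u n ∈ S} :=
  (isOpen_discrete S).preimage (continuous_apply n)

lemma aux_isOpen_prefix (a : ℕ → Bool) (n : ℕ) : IsOpen {u : ℕ → Bool | ∀ m, m < n → u m = a m} := by
  have : {u : ℕ → Bool | ∀ m, m < n → u m = a m} = ⋂ m ∈ Finset.range n, {u | u m ∈ ({a m} : Set Bool)} := by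
    ext u; simp
  rw [this]
  exact isOpen_biInter_finset fun m _ => aux_isOpen_eval m _

lemma aux_isOpen_gt (a : ℕ → Bool) : IsOpen {u | lexLt a u} := by
  have : {u | lexLt a u} = ⋃ n, ({u : ℕ → Bool | ∀ m, m < n → u m = a m} ∩ {u | u n ∈ Set.Ioi (a n)}) := by
    ext u
    simp only [lexLt, Set.mem_setOf_eq, Set.mem_iUnion, Set.mem_inter_iff, Set.mem_Ioi]
    exact exists_congr fun n => and_congr_left fun _ =>
      forall_congr' fun m => forall_congr' fun _ => eq_comm
  rw [this]
  exact isOpen_iUnion fun n => (aux_isOpen_prefix a n).inter (aux_isOpen_eval n _)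

lemma aux_isOpen_lt (a : ℕ → Bool) : IsOpen {u | lexLt u a} := by
  have : {u | lexLt u a} = ⋃ n, ({u : ℕ → Bool | ∀ m, m < n → u m = a m} ∩ {u | u n ∈ Set.Iio (a n)}) := by
    ext u
    simp [lexLt]
  rw [this]
  exact isOpen_iUnion fun n => (aux_isOpen_prefix a n).inter (aux_isOpen_eval n _)

lemma aux_isCompact_cyl (a b : ℕ → Bool) (d : Bool) : IsCompact (cyl a b d) := by
  apply IsClosed.isCompact
  have h1 : IsClosed (Omega a b) := by
    have : Omega a b = ⋂ n, (fun i => shiftTail i n) ⁻¹' ({u | lexLt a u} ∩ {u | lexLt u b})ᶜ := by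
      ext u; simp [Omega]
    rw [this]
    refine isClosed_iInter fun n => IsClosed.preimage ?_ ?_
    · exact continuous_pi fun k => continuous_apply (n + k)
    · exact ((aux_isOpen_gt a).inter (aux_isOpen_lt b)).isClosed_compl
  have h2 : IsClosed {i : ℕ → Bool | i 0 = d} :=
    isClosed_eq (continuous_apply 0) continuous_const
  exact h1.inter h2

lemma aux_qb_ge {q0 q1 : ℝ} (d : Bool) : min q0 q1 ≤ qb q0 q1 d := by
  cases d <;> simp [qb]

lemma aux_term_bound {q0 q1 : ℝ} (hq0 : 1 < q0) (hq1 : 1 < q1) (k : ℕ) (i : ℕ → Bool) :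
    ‖(if i k then (1 : ℝ) else 0) / ∏ j ∈ Finset.range (k + 1), qb q0 q1 (i j)‖
      ≤ ((min q0 q1)⁻¹) ^ (k + 1) := by
  have hr : 1 < min q0 q1 := lt_min hq0 hq1
  have hp : (min q0 q1) ^ (k + 1) ≤ ∏ j ∈ Finset.range (k + 1), qb q0 q1 (i j) := by
    have := Finset.prod_le_prod (s := Finset.range (k + 1)) (f := fun _ => min q0 q1)
      (g := fun j => qb q0 q1 (i j)) (fun _ _ => by positivity) (fun j _ => aux_qb_ge (i j))
    simpa using this
  have hpos : 0 < (min q0 q1) ^ (k + 1) := by positivity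
  have hpos' := hpos.trans_le hp
  rw [norm_div, Real.norm_of_nonneg hpos'.le, inv_pow, ← one_div]
  apply div_le_div₀ zero_le_one _ hpos hp
  split_ifs <;> simp

lemma aux_geom {q0 q1 : ℝ} (hq0 : 1 < q0) (hq1 : 1 < q1) :
    Summable fun k : ℕ => ((min q0 q1)⁻¹) ^ (k + 1) := by
  have hr : 1 < min q0 q1 := lt_min hq0 hq1
  exact (summable_nat_add_iff 1).2
    (summable_geometric_of_lt_one (by positivity) (inv_lt_one_of_one_lt₀ hr))

lemma aux_cont {q0 q1 : ℝ} (hq0 : 1 < q0) (hq1 : 1 < q1) : Continuous (piE q0 q1) := by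
  unfold piE
  refine continuous_tsum ?_ (aux_geom hq0 hq1) (fun k i => aux_term_bound hq0 hq1 k i)
  intro k
  refine Continuous.div ?_ ?_ ?_
  · exact (continuous_of_discreteTopology (f := fun d : Bool => if d then (1 : ℝ) else 0)).comp
      (continuous_apply k)
  · exact continuous_finsetProd _ fun j _ =>
      (continuous_of_discreteTopology (f := qb q0 q1)).comp (continuous_apply j)
  · intro i
    refine Finset.prod_ne_zero_iff.2 fun j _ => ?_
    cases i j <;> simp [qb] <;> linarith

lemma aux_abs {q0 q1 : ℝ} (hq0 : 1 < q0) (hq1 : 1 < q1) :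
    ∃ C, ∀ i, |piE q0 q1 i| ≤ C :=
  ⟨_, fun i => tsum_of_norm_bounded (aux_geom hq0 hq1).hasSum
    (fun k => aux_term_bound hq0 hq1 k i)⟩

lemma aux_rec {q0 q1 : ℝ} (hq0 : 1 < q0) (hq1 : 1 < q1) (i : ℕ → Bool) :
    qb q0 q1 (i 0) * piE q0 q1 i = (if i 0 then 1 else 0) + piE q0 q1 (fun k => i (k + 1)) := by
  have hs : Summable fun k : ℕ =>
      (if i k then (1 : ℝ) else 0) / ∏ j ∈ Finset.range (k + 1), qb q0 q1 (i j) :=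
    Summable.of_norm_bounded (aux_geom hq0 hq1) (fun k => aux_term_bound hq0 hq1 k i)
  have hne : qb q0 q1 (i 0) ≠ 0 := by cases i 0 <;> simp [qb] <;> linarith
  unfold piE
  rw [hs.tsum_eq_zero_add, mul_add, ← tsum_mul_left]
  congr 1
  · simp; field_simp
  · refine tsum_congr fun k => ?_
    rw [Finset.prod_range_succ' _ (k + 1)]
    field_simp

/-- `X` is an orbit with digits `d`. -/
def IsOrb (q0 q1 : ℝ) (d : ℕ → Bool) (X : ℕ → ℝ) : Prop :=
  ∀ n, X (n + 1) = qb q0 q1 (d n) * X n - (if d n then 1 else 0)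

lemma aux_orb_pi {q0 q1 : ℝ} (hq0 : 1 < q0) (hq1 : 1 < q1) (i : ℕ → Bool) :
    IsOrb q0 q1 i (fun n => piE q0 q1 (shiftTail i n)) := by
  intro n
  have h := aux_rec hq0 hq1 (shiftTail i n)
  have e : (fun k => shiftTail i n (k + 1)) = shiftTail i (n + 1) := by
    funext k; simp only [shiftTail]; congr 1; ring
  have e0 : shiftTail i n 0 = i n := rfl
  rw [e, e0] at h
  linarith

lemma aux_shift0 (i : ℕ → Bool) : shiftTail i 0 = i := by
  funext k; simp [shiftTail]

lemma aux_shift_shift (i : ℕ → Bool) (n m : ℕ) :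
    shiftTail (shiftTail i n) m = shiftTail i (n + m) := by
  funext k; simp [shiftTail, add_assoc]

lemma aux_omega_shift {a b i : ℕ → Bool} (h : i ∈ Omega a b) (n : ℕ) :
    shiftTail i n ∈ Omega a b := by
  intro m
  rw [aux_shift_shift]
  exact h _

/-- Comparison of two orbits with a common prefix of digits. -/
lemma aux_cmp {q0 q1 : ℝ} (hq0 : 1 < q0) (hq1 : 1 < q1) {d e : ℕ → Bool} {X Y : ℕ → ℝ}
    (hX : IsOrb q0 q1 d X) (hY : IsOrb q0 q1 e Y) (n : ℕ) (hde : ∀ m, m < n → d m = e m) :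
    ∃ c : ℝ, 1 ≤ c ∧ X n - Y n = c * (X 0 - Y 0) := by
  induction n with
  | zero => exact ⟨1, le_rfl, by ring⟩
  | succ n ih =>
    obtain ⟨c, hc, h⟩ := ih fun m hm => hde m (hm.trans n.lt_succ_self)
    have hq : 1 ≤ qb q0 q1 (e n) := by cases e n <;> simp [qb] <;> linarith
    refine ⟨qb q0 q1 (e n) * c, by nlinarith, ?_⟩
    rw [hX n, hY n, hde n n.lt_succ_self, mul_assoc, ← h]
    ring

lemma aux_unique {q0 q1 : ℝ} (hq0 : 1 < q0) (hq1 : 1 < q1) {d : ℕ → Bool} {X Y : ℕ → ℝ}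
    (hX : IsOrb q0 q1 d X) (hY : IsOrb q0 q1 d Y) (C : ℝ) (hC : ∀ n, |X n - Y n| ≤ C) :
    X 0 = Y 0 := by
  have hr : 1 < min q0 q1 := lt_min hq0 hq1
  by_contra hne
  have hpos : 0 < |X 0 - Y 0| := abs_pos.2 (sub_ne_zero.2 hne)
  have key : ∀ n, (min q0 q1) ^ n * |X 0 - Y 0| ≤ |X n - Y n| := by
    intro n
    induction n with
    | zero => simp
    | succ n ih =>
      have e : X (n + 1) - Y (n + 1) = qb q0 q1 (d n) * (X n - Y n) := by
        rw [hX n, hY n]; ring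
      have hq := aux_qb_ge (q0 := q0) (q1 := q1) (d n)
      have hq' : 0 ≤ qb q0 q1 (d n) := by linarith
      rw [e, abs_mul, abs_of_nonneg hq', pow_succ', mul_assoc]
      gcongr
  obtain ⟨n, hn⟩ := pow_unbounded_of_one_lt (C / |X 0 - Y 0|) hr
  rw [div_lt_iff₀ hpos] at hn
  linarith [key n, hC n]

lemma aux_range {q0 q1 : ℝ} (hq0 : 1 < q0) (hq1 : 1 < q1) (i : ℕ → Bool) :
    piE q0 q1 i ∈ Set.Icc 0 (1 / (q1 - 1)) := by
  have hs : ∀ k : ℕ, 0 ≤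
      (if i k then (1 : ℝ) else 0) / ∏ j ∈ Finset.range (k + 1), qb q0 q1 (i j) := by
    intro k
    apply div_nonneg
    · split_ifs <;> simp
    · refine Finset.prod_nonneg fun j _ => ?_
      cases i j <;> simp [qb] <;> linarith
  refine ⟨tsum_nonneg hs, ?_⟩
  have hr : 1 < min q0 q1 := lt_min hq0 hq1
  have hM : (0 : ℝ) < 1 / (q1 - 1) := by
    have : 0 < q1 - 1 := by linarith
    positivity
  have hM1 : q1 * (1 / (q1 - 1)) = 1 + 1 / (q1 - 1) := by
    have : q1 - 1 ≠ 0 := by linarith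
    field_simp; ring
  set M := 1 / (q1 - 1)
  by_contra hlt
  push Not at hlt
  have horb := aux_orb_pi hq0 hq1 i
  obtain ⟨C, hC⟩ := aux_abs hq0 hq1
  have key : ∀ n, (min q0 q1) ^ n * (piE q0 q1 i - M) ≤ piE q0 q1 (shiftTail i n) - M := by
    intro n
    induction n with
    | zero => simp [aux_shift0]
    | succ n ih =>
      have h := horb n
      simp only at h
      have h0 : 0 ≤ (min q0 q1) ^ n * (piE q0 q1 i - M) := by
        apply mul_nonneg (by positivity); linarith
      have hq := aux_qb_ge (q0 := q0) (q1 := q1) (i n)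
      have h3 : (min q0 q1) ^ (n + 1) * (piE q0 q1 i - M)
          ≤ qb q0 q1 (i n) * (piE q0 q1 (shiftTail i n) - M) := by
        have hq' : 0 ≤ qb q0 q1 (i n) := by linarith
        rw [pow_succ', mul_assoc]
        gcongr
      refine h3.trans ?_
      rw [h]
      cases i n
      · simp [qb]; nlinarith
      · simp [qb]; nlinarith
  obtain ⟨n, hn⟩ := pow_unbounded_of_one_lt (C / (piE q0 q1 i - M)) hr
  rw [div_lt_iff₀ (by linarith)] at hn
  linarith [key n, le_abs_self (piE q0 q1 (shiftTail i n)), hC (shiftTail i n)]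

/-- The lazy map with threshold `P`. -/
noncomputable def lazyT (q0 q1 P : ℝ) (x : ℝ) : ℝ := open Classical in
  if P < x then q1 * x - 1 else q0 * x

/-- Lemma 2.4: if `max π_{q₀,q₁}([0]_{a,b}) ≥ min π_{q₀,q₁}([1]_{a,b})`, then
`π_{q₀,q₁}(Ω_{a,b}) = [0, 1/(q₁−1)]`. -/
theorem stmt14 (a b : ℕ → Bool) (q0 q1 : ℝ) (ha : a 0 = false) (hb : b 0 = true)
    (hq0 : 1 < q0) (hq1 : 1 < q1)
    (hsep : sInf (piE q0 q1 '' cyl a b true) ≤ sSup (piE q0 q1 '' cyl a b false)) :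
    piE q0 q1 '' Omega a b = Set.Icc 0 (1 / (q1 - 1)) := by
  classical
  have hM1 : q1 * (1 / (q1 - 1)) = 1 + 1 / (q1 - 1) := by
    have : q1 - 1 ≠ 0 := by linarith
    field_simp; ring
  apply Set.Subset.antisymm
  · rintro _ ⟨i, _, rfl⟩
    exact aux_range hq0 hq1 i
  intro x hx
  have hcont := aux_cont hq0 hq1
  have hKf := (aux_isCompact_cyl a b false).image hcont
  have hKt := (aux_isCompact_cyl a b true).image hcont
  have hnef : (cyl a b false).Nonempty := by
    refine ⟨fun _ => false, ?_, rfl⟩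
    rintro n ⟨⟨k, -, hk⟩, -⟩
    simp [shiftTail, Bool.lt_iff] at hk
  have hnet : (cyl a b true).Nonempty := by
    refine ⟨fun _ => true, ?_, rfl⟩
    rintro n ⟨-, ⟨k, -, hk⟩⟩
    simp [shiftTail, Bool.lt_iff] at hk
  have hPmem := hKf.sSup_mem (hnef.image _)
  have hmmem := hKt.sInf_mem (hnet.image _)
  have hPub : ∀ i ∈ cyl a b false, piE q0 q1 i ≤ sSup (piE q0 q1 '' cyl a b false) :=
    fun i hi => le_csSup hKf.bddAbove ⟨i, hi, rfl⟩
  have hmlb : ∀ i ∈ cyl a b true, sInf (piE q0 q1 '' cyl a b true) ≤ piE q0 q1 i :=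
    fun i hi => csInf_le hKt.bddBelow ⟨i, hi, rfl⟩
  generalize sSup (piE q0 q1 '' cyl a b false) = P at *
  generalize sInf (piE q0 q1 '' cyl a b true) = m at *
  obtain ⟨w, ⟨hwO, hw0⟩, hwP⟩ := hPmem
  obtain ⟨v, ⟨hvO, hv0⟩, hvm⟩ := hmmem
  have hPM : q0 * P ≤ 1 / (q1 - 1) := by
    have h := aux_rec hq0 hq1 w
    rw [hw0, hwP] at h
    simp only [qb, Bool.false_eq_true, if_false, zero_add] at h
    rw [h]; exact (aux_range hq0 hq1 _).2
  have hm0 : 0 ≤ q1 * m - 1 := by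
    have h := aux_rec hq0 hq1 v
    rw [hv0, hvm] at h
    simp only [qb, if_true] at h
    have := (aux_range hq0 hq1 (fun k => v (k + 1))).1
    linarith
  set X : ℕ → ℝ := fun n => (lazyT q0 q1 P)^[n] x with hXdef
  set d : ℕ → Bool := fun n => decide (P < X n) with hd
  have hX1 : ∀ n, X (n + 1) = lazyT q0 q1 P (X n) := fun n =>
    Function.iterate_succ_apply' _ _ _
  have hdt : ∀ n, d n = true → P < X n := fun n h => by simpa [hd] using h
  have hdf : ∀ n, d n = false → X n ≤ P := fun n h => by simpa [hd] using h
  have hXr : ∀ n, X n ∈ Set.Icc 0 (1 / (q1 - 1)) := by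
    intro n
    induction n with
    | zero => exact hx
    | succ n ih =>
      rw [hX1]
      unfold lazyT
      split_ifs with h
      · constructor
        · nlinarith
        · nlinarith [ih.2]
      · constructor
        · nlinarith [ih.1]
        · nlinarith
  have horb : IsOrb q0 q1 d X := by
    intro n
    rw [hX1]
    unfold lazyT
    by_cases h : P < X n <;> simp [hd, h, qb]
  have horbN : ∀ N, IsOrb q0 q1 (shiftTail d N) (fun n => X (N + n)) := fun N n => horb (N + n)
  refine ⟨d, ?_, ?_⟩
  swap
  · obtain ⟨C, hC⟩ := aux_abs hq0 hq1
    have := aux_unique hq0 hq1 horb (aux_orb_pi hq0 hq1 d) (1 / (q1 - 1) + C) (by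
      intro n
      have h1 := hXr n
      have h2 := abs_le.1 (hC (shiftTail d n))
      have h3 := (aux_range hq0 hq1 (shiftTail d n)).1
      have h4 := h1.1
      have h5 := h1.2
      rw [abs_le]
      constructor <;> linarith)
    simp only [aux_shift0] at this
    exact this.symm
  rintro N ⟨h1, h2⟩
  cases hdN : d N
  · -- tail starts with 0
    have haw : ¬ lexLt a w := fun h => by
      have := hwO 0
      rw [aux_shift0] at this
      exact this ⟨h, 0, by simp, by rw [hw0, hb]; decide⟩
    rcases aux_lexLt_tri (shiftTail d N) w with h | h | h
    · exact haw (aux_lexLt_trans h1 h)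
    · exact haw (h ▸ h1)
    · obtain ⟨n, hn, hn'⟩ := h
      obtain ⟨hwn, hdn⟩ := Bool.lt_iff.1 hn'
      obtain ⟨c, hc, hcmp⟩ := aux_cmp hq0 hq1 (aux_orb_pi hq0 hq1 w) (horbN N) n hn
      have hA := hdt _ hdn
      have hB := hPub (shiftTail w n) ⟨aux_omega_shift hwO n, hwn⟩
      have hC := hdf N hdN
      simp only [aux_shift0, hwP, add_zero] at hcmp
      nlinarith
  · have hvb : ¬ lexLt v b := fun h => by
      have := hvO 0
      rw [aux_shift0] at this
      exact this ⟨⟨0, by simp, by rw [hv0, ha]; decide⟩, h⟩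
    rcases aux_lexLt_tri v (shiftTail d N) with h | h | h
    · exact hvb (aux_lexLt_trans h h2)
    · exact hvb (h ▸ h2)
    · obtain ⟨n, hn, hn'⟩ := h
      obtain ⟨hdn, hvn⟩ := Bool.lt_iff.1 hn'
      obtain ⟨c, hc, hcmp⟩ := aux_cmp hq0 hq1 (horbN N) (aux_orb_pi hq0 hq1 v) n hn
      have hA := hdf _ hdn
      have hB := hmlb (shiftTail v n) ⟨aux_omega_shift hvO n, hvn⟩
      have hC := hdt N hdN
      simp only [aux_shift0, hvm, add_zero] at hcmp
      nlinarith
end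

section
/- Let a ∈ {0,1}^ℕ start with digit 0 and let b ∈ {0,1}^ℕ start with digit 1. Then the map (q₀,q₁) ↦ dim_H π_{q₀,q₁}(Ω_{a,b}) is continuous on (1,∞) × (1,∞). -/
open Filter Topology

namespace S19

lemma qb_gt {q0 q1 : ℝ} (h0 : 1 < q0) (h1 : 1 < q1) (d : Bool) : 1 < qb q0 q1 d := by
  cases d <;> simp [qb, h0, h1]

lemma prod_ge {q0 q1 : ℝ} (h0 : 1 < q0) (h1 : 1 < q1) (i : ℕ → Bool) (n : ℕ) :
    (min q0 q1) ^ n ≤ ∏ j ∈ Finset.range n, qb q0 q1 (i j) := by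
  have hm : 1 < min q0 q1 := lt_min h0 h1
  induction n with
  | zero => simp
  | succ n ih =>
    rw [Finset.prod_range_succ, pow_succ]
    have h : min q0 q1 ≤ qb q0 q1 (i n) := by
      cases i n <;> simp [qb]
    exact mul_le_mul ih h (by linarith) (le_trans (by positivity) ih)

lemma prod_ge_one {q0 q1 : ℝ} (h0 : 1 < q0) (h1 : 1 < q1) (i : ℕ → Bool) (n : ℕ) :
    1 ≤ ∏ j ∈ Finset.range n, qb q0 q1 (i j) :=
  le_trans (one_le_pow₀ (lt_min h0 h1).le) (prod_ge h0 h1 i n)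

lemma term_bound {q0 q1 : ℝ} (h0 : 1 < q0) (h1 : 1 < q1) (i : ℕ → Bool) (k : ℕ) :
    ‖(if i k then (1 : ℝ) else 0) / ∏ j ∈ Finset.range (k + 1), qb q0 q1 (i j)‖
      ≤ ((min q0 q1)⁻¹) ^ k := by
  have hm : 1 < min q0 q1 := lt_min h0 h1
  have h := prod_ge h0 h1 i (k + 1)
  have hp := prod_ge_one h0 h1 i (k + 1)
  rw [norm_div, Real.norm_of_nonneg (by linarith : (0:ℝ) ≤ ∏ j ∈ Finset.range (k + 1), qb q0 q1 (i j)),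
    inv_pow]
  have h2 : (min q0 q1) ^ k ≤ (min q0 q1) ^ (k+1) := pow_le_pow_right₀ hm.le (by omega)
  have h3 : 0 < (min q0 q1) ^ k := by positivity
  calc _ ≤ 1 / ∏ j ∈ Finset.range (k + 1), qb q0 q1 (i j) := by
        gcongr
        split_ifs <;> simp
    _ ≤ 1 / (min q0 q1) ^ k := by
        apply one_div_le_one_div_of_le h3; linarith
    _ = _ := by simp

lemma geo {q0 q1 : ℝ} (h0 : 1 < q0) (h1 : 1 < q1) :
    Summable fun k : ℕ => ((min q0 q1)⁻¹) ^ k := by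
  have hm : 1 < min q0 q1 := lt_min h0 h1
  exact summable_geometric_of_lt_one (by positivity) (inv_lt_one_of_one_lt₀ hm)

lemma summ {q0 q1 : ℝ} (h0 : 1 < q0) (h1 : 1 < q1) (i : ℕ → Bool) :
    Summable fun k : ℕ =>
      (if i k then (1 : ℝ) else 0) / ∏ j ∈ Finset.range (k + 1), qb q0 q1 (i j) :=
  Summable.of_norm_bounded (geo h0 h1) (term_bound h0 h1 i)

lemma piE_cont {q0 q1 : ℝ} (h0 : 1 < q0) (h1 : 1 < q1) : Continuous (piE q0 q1) := by
  unfold piE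
  refine continuous_tsum (u := fun k : ℕ => ((min q0 q1)⁻¹) ^ k) ?_ (geo h0 h1)
    (fun n x => term_bound h0 h1 x n)
  intro k
  refine Continuous.div ?_ ?_ ?_
  · exact (continuous_of_discreteTopology (f := fun d : Bool => if d then (1:ℝ) else 0)).comp
      (continuous_apply k)
  · refine continuous_finsetProd _ fun j _ => ?_
    exact (continuous_of_discreteTopology (f := fun d : Bool => qb q0 q1 d)).comp
      (continuous_apply j)
  · intro i
    have := prod_ge_one h0 h1 i (k+1)
    linarith

lemma piE_rec {q0 q1 : ℝ} (h0 : 1 < q0) (h1 : 1 < q1) (i : ℕ → Bool) :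
    piE q0 q1 i = ((if i 0 then (1 : ℝ) else 0) + piE q0 q1 (shiftTail i 1)) / qb q0 q1 (i 0) := by
  unfold piE
  rw [(summ h0 h1 i).tsum_eq_zero_add, add_div, ← tsum_div_const]
  congr 1
  · simp
  · congr 1
    ext k
    rw [Finset.prod_range_succ' _ (k+1), div_div]
    simp [shiftTail, add_comm]

lemma shift_shift (i : ℕ → Bool) (m n : ℕ) :
    shiftTail (shiftTail i m) n = shiftTail i (m + n) := by
  ext k; simp [shiftTail, add_assoc]

lemma shift_zero (i : ℕ → Bool) : shiftTail i 0 = i := by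
  ext k; simp [shiftTail]

lemma piE_sub {q0 q1 : ℝ} (h0 : 1 < q0) (h1 : 1 < q1) (n : ℕ) : ∀ (i j : ℕ → Bool),
    (∀ m, m < n → i m = j m) →
    piE q0 q1 i - piE q0 q1 j =
      (piE q0 q1 (shiftTail i n) - piE q0 q1 (shiftTail j n)) /
        ∏ k ∈ Finset.range n, qb q0 q1 (i k) := by
  induction n with
  | zero => intro i j _; simp [shift_zero]
  | succ n ih =>
    intro i j h
    have h00 := h 0 (by omega)
    have := ih (shiftTail i 1) (shiftTail j 1) (by
      intro m hm; simp only [shiftTail]; exact h _ (by omega))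
    rw [piE_rec h0 h1 i, piE_rec h0 h1 j, ← h00, ← sub_div, add_sub_add_left_eq_sub, this,
      shift_shift, shift_shift, Finset.prod_range_succ', div_div, add_comm 1 n]
    congr 2
    apply Finset.prod_congr rfl
    intro k _
    simp [shiftTail, add_comm]

lemma piE_nonneg {q0 q1 : ℝ} (h0 : 1 < q0) (h1 : 1 < q1) (i : ℕ → Bool) : 0 ≤ piE q0 q1 i := by
  refine tsum_nonneg fun k => div_nonneg (by split_ifs <;> norm_num) ?_
  linarith [prod_ge_one h0 h1 i (k+1)]

lemma piE_le {q0 q1 : ℝ} (h0 : 1 < q0) (h1 : 1 < q1) (i : ℕ → Bool) :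
    piE q0 q1 i ≤ 1 / (q1 - 1) := by
  obtain ⟨j, -, hj⟩ := isCompact_univ.exists_isMaxOn (Set.univ_nonempty)
    (piE_cont h0 h1).continuousOn
  have hj' : ∀ i, piE q0 q1 i ≤ piE q0 q1 j := fun i => hj (Set.mem_univ i)
  refine (hj' i).trans ?_
  have hr := piE_rec h0 h1 j
  have hs := hj' (shiftTail j 1)
  have hpos : 0 < q1 - 1 := by linarith
  cases hd : j 0
  · rw [hd] at hr
    simp only [qb, Bool.false_eq_true, if_false, zero_add] at hr
    rw [eq_div_iff (by linarith)] at hr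
    have : piE q0 q1 j ≤ 0 := by nlinarith
    exact this.trans (by positivity)
  · rw [hd] at hr
    simp only [qb, if_true] at hr
    rw [eq_div_iff (by linarith)] at hr
    rw [le_div_iff₀ hpos]
    nlinarith

/-- first difference -/
lemma first_diff {u v : ℕ → Bool} (h : u ≠ v) :
    ∃ n, (∀ m, m < n → u m = v m) ∧ u n ≠ v n := by
  classical
  have hex : ∃ n, u n ≠ v n := by
    by_contra hc
    push Not at hc
    exact h (funext hc)
  refine ⟨Nat.find hex, fun m hm => ?_, Nat.find_spec hex⟩
  have := Nat.find_min hex hm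
  simpa using this

lemma lex_tri {u v : ℕ → Bool} (h : u ≠ v) : lexLt u v ∨ lexLt v u := by
  obtain ⟨n, hn, hne⟩ := first_diff h
  rcases lt_or_gt_of_ne hne with h | h
  · exact Or.inl ⟨n, hn, h⟩
  · exact Or.inr ⟨n, fun m hm => (hn m hm).symm, h⟩

lemma lex_trans {u v w : ℕ → Bool} (h : lexLt u v) (h' : lexLt v w) : lexLt u w := by
  obtain ⟨n, hn, hl⟩ := h
  obtain ⟨m, hm, hl'⟩ := h'
  rcases lt_trichotomy n m with h | h | h
  · exact ⟨n, fun k hk => (hn k hk).trans (hm k (by omega)), (hm n h) ▸ hl⟩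
  · subst h
    exact ⟨n, fun k hk => (hn k hk).trans (hm k (by omega)), hl.trans hl'⟩
  · exact ⟨m, fun k hk => (hn k (by omega)).trans (hm k hk), (hn m h) ▸ hl'⟩

lemma omega_shift {a b i : ℕ → Bool} (h : i ∈ Omega a b) (n : ℕ) : shiftTail i n ∈ Omega a b := by
  intro m
  rw [shift_shift]
  exact h _

lemma isOpen_lex_left (a : ℕ → Bool) : IsOpen {u | lexLt a u} := by
  have : {u | lexLt a u} = ⋃ n : ℕ, ((⋂ m ∈ Finset.range n, {u : ℕ → Bool | a m = u m}) ∩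
      {u | a n < u n}) := by
    ext u; simp [lexLt]
  rw [this]
  refine isOpen_iUnion fun n => IsOpen.inter ?_ ?_
  · refine isOpen_biInter_finset fun m _ => ?_
    exact (isOpen_discrete {d : Bool | a m = d}).preimage
      (continuous_apply m : Continuous fun u : ℕ → Bool => u m)
  · exact (isOpen_discrete {d : Bool | a n < d}).preimage
      (continuous_apply n : Continuous fun u : ℕ → Bool => u n)

lemma isOpen_lex_right (b : ℕ → Bool) : IsOpen {u | lexLt u b} := by
  have : {u | lexLt u b} = ⋃ n : ℕ, ((⋂ m ∈ Finset.range n, {u : ℕ → Bool | u m = b m}) ∩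
      {u | u n < b n}) := by
    ext u; simp [lexLt]
  rw [this]
  refine isOpen_iUnion fun n => IsOpen.inter ?_ ?_
  · refine isOpen_biInter_finset fun m _ => ?_
    exact (isOpen_discrete {d : Bool | d = b m}).preimage
      (continuous_apply m : Continuous fun u : ℕ → Bool => u m)
  · exact (isOpen_discrete {d : Bool | d < b n}).preimage
      (continuous_apply n : Continuous fun u : ℕ → Bool => u n)

lemma isClosed_Omega (a b : ℕ → Bool) : IsClosed (Omega a b) := by
  have : Omega a b = ⋂ n : ℕ, (fun i => shiftTail i n) ⁻¹' ({u | lexLt a u} ∩ {u | lexLt u b})ᶜ := by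
    ext i; simp [Omega]
  rw [this]
  refine isClosed_iInter fun n => IsClosed.preimage ?_ ?_
  · exact continuous_pi fun k => continuous_apply (n + k)
  · exact ((isOpen_lex_left a).inter (isOpen_lex_right b)).isClosed_compl

lemma compact_part (a b : ℕ → Bool) (d : Bool) : IsCompact (Omega a b ∩ {i | i 0 = d}) := by
  apply IsClosed.isCompact
  exact (isClosed_Omega a b).inter
    ((isClosed_discrete {e : Bool | e = d}).preimage
      (continuous_apply 0 : Continuous fun u : ℕ → Bool => u 0))

lemma const_false_mem {a b : ℕ → Bool} : (fun _ => false) ∈ Omega a b := by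
  rintro n ⟨⟨m, -, hm⟩, -⟩
  revert hm
  simp only [shiftTail]
  cases a m <;> simp

lemma const_true_mem {a b : ℕ → Bool} : (fun _ => true) ∈ Omega a b := by
  rintro n ⟨-, ⟨m, -, hm⟩⟩
  revert hm
  simp only [shiftTail]
  cases b m <;> simp

/-- gap condition -/
def Gap (a b : ℕ → Bool) (q0 q1 : ℝ) : Prop :=
  ∃ δ > 0, ∀ i ∈ Omega a b, ∀ j ∈ Omega a b, i 0 = false → j 0 = true →
    δ ≤ piE q0 q1 j - piE q0 q1 i

noncomputable def T (q0 q1 c x : ℝ) : ℝ := if c ≤ x then q1 * x - 1 else q0 * x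

noncomputable def kap (q0 q1 c x : ℝ) : ℕ → Bool := fun n => decide (c ≤ (T q0 q1 c)^[n] x)

lemma kap_shift (q0 q1 c x : ℝ) (n : ℕ) :
    shiftTail (kap q0 q1 c x) n = kap q0 q1 c ((T q0 q1 c)^[n] x) := by
  ext k
  simp only [shiftTail, kap]
  rw [← Function.iterate_add_apply, add_comm n k]

lemma T_rec {q0 q1 : ℝ} (h0 : 1 < q0) (h1 : 1 < q1) (c x : ℝ) :
    x = ((if kap q0 q1 c x 0 then (1 : ℝ) else 0) + T q0 q1 c x) / qb q0 q1 (kap q0 q1 c x 0) := by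
  have : q0 ≠ 0 := by linarith
  have : q1 ≠ 0 := by linarith
  by_cases h : c ≤ x
  · simp [kap, T, qb, h]; field_simp
  · simp [kap, T, qb, h]; field_simp

lemma kap_pi {q0 q1 c : ℝ} (h0 : 1 < q0) (h1 : 1 < q1)
    (hT : ∀ x ∈ Set.Icc 0 (1 / (q1 - 1)), T q0 q1 c x ∈ Set.Icc 0 (1 / (q1 - 1)))
    {x : ℝ} (hx : x ∈ Set.Icc 0 (1 / (q1 - 1))) : piE q0 q1 (kap q0 q1 c x) = x := by
  have hm : 1 < min q0 q1 := lt_min h0 h1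
  have key : ∀ n : ℕ, ∀ x ∈ Set.Icc 0 (1 / (q1 - 1)),
      |piE q0 q1 (kap q0 q1 c x) - x| ≤ ((min q0 q1)⁻¹) ^ n * (1 / (q1 - 1)) := by
    intro n
    induction n with
    | zero =>
      intro x hx
      have ha := piE_nonneg h0 h1 (kap q0 q1 c x)
      have hb := piE_le h0 h1 (kap q0 q1 c x)
      rw [abs_le]
      constructor <;> simp only [pow_zero, one_mul] <;> linarith [hx.1, hx.2]
    | succ n ih =>
      intro x hx
      have h := ih _ (hT x hx)
      have e1 := piE_rec h0 h1 (kap q0 q1 c x)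
      have e2 := T_rec h0 h1 c x
      have e3 := kap_shift q0 q1 c x 1
      simp only [Function.iterate_one] at e3
      rw [e3] at e1
      have hq : min q0 q1 ≤ qb q0 q1 (kap q0 q1 c x 0) := by
        cases kap q0 q1 c x 0 <;> simp [qb]
      have hq1 := qb_gt h0 h1 (kap q0 q1 c x 0)
      have e4 : piE q0 q1 (kap q0 q1 c x) - x =
          (piE q0 q1 (kap q0 q1 c (T q0 q1 c x)) - T q0 q1 c x) / qb q0 q1 (kap q0 q1 c x 0) := by
        calc _ = _ - _ := congrArg₂ (· - ·) e1 e2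
            _ = _ := by ring
      rw [e4, abs_div, abs_of_pos (by linarith : 0 < qb q0 q1 (kap q0 q1 c x 0)), div_eq_inv_mul,
        pow_succ', mul_assoc]
      exact mul_le_mul (inv_anti₀ (by linarith) hq) h (abs_nonneg _) (by positivity)
  have hlim : Tendsto (fun n : ℕ => ((min q0 q1)⁻¹) ^ n * (1 / (q1 - 1))) atTop (𝓝 0) := by
    have := (tendsto_pow_atTop_nhds_zero_of_lt_one (r := (min q0 q1)⁻¹) (by positivity)
      (inv_lt_one_of_one_lt₀ hm)).mul_const (1 / (q1 - 1))
    simpa using this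
  have := ge_of_tendsto' hlim (fun n => key n x hx)
  have h3 := abs_nonneg (piE q0 q1 (kap q0 q1 c x) - x)
  have : |piE q0 q1 (kap q0 q1 c x) - x| = 0 := le_antisymm this h3
  linarith [abs_eq_zero.1 this]

lemma dichotomy (a b : ℕ → Bool) (ha : a 0 = false) (hb : b 0 = true) {q0 q1 : ℝ}
    (h0 : 1 < q0) (h1 : 1 < q1) :
    Gap a b q0 q1 ∨ Set.Icc 0 (1 / (q1 - 1)) ⊆ piE q0 q1 '' Omega a b := by
  obtain ⟨i, ⟨hi, hi0⟩, himax⟩ := (compact_part a b false).exists_isMaxOn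
    ⟨_, const_false_mem, rfl⟩ (piE_cont h0 h1).continuousOn
  obtain ⟨j, ⟨hj, hj0⟩, hjmin⟩ := (compact_part a b true).exists_isMinOn
    ⟨_, const_true_mem, rfl⟩ (piE_cont h0 h1).continuousOn
  have himax' : ∀ u ∈ Omega a b, u 0 = false → piE q0 q1 u ≤ piE q0 q1 i :=
    fun u hu h => himax ⟨hu, h⟩
  have hjmin' : ∀ u ∈ Omega a b, u 0 = true → piE q0 q1 j ≤ piE q0 q1 u :=
    fun u hu h => hjmin ⟨hu, h⟩
  simp only [Set.mem_ofPred_eq] at hi0 hj0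
  by_cases hlt : piE q0 q1 i < piE q0 q1 j
  · left
    refine ⟨piE q0 q1 j - piE q0 q1 i, by linarith, fun u hu v hv hu0 hv0 => ?_⟩
    linarith [himax' u hu hu0, hjmin' v hv hv0]
  right
  push Not at hlt
  obtain ⟨c, hc⟩ : ∃ c, c = piE q0 q1 i := ⟨_, rfl⟩
  rw [← hc] at hlt himax'
  have hm : 0 < q1 - 1 := by linarith
  have hmm : (1 / (q1 - 1)) * (q1 - 1) = 1 := by field_simp
  have hc1 : 1 ≤ q1 * c := by
    have := piE_rec h0 h1 j
    rw [hj0] at this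
    simp only [qb, if_true] at this
    rw [eq_div_iff (by linarith)] at this
    nlinarith [piE_nonneg h0 h1 (shiftTail j 1)]
  have hc2 : q0 * c ≤ 1 / (q1 - 1) := by
    have := piE_rec h0 h1 i
    rw [hi0, ← hc] at this
    simp only [qb, Bool.false_eq_true, if_false, zero_add] at this
    rw [eq_div_iff (by linarith)] at this
    linarith [piE_le h0 h1 (shiftTail i 1)]
  have hT : ∀ x ∈ Set.Icc 0 (1 / (q1 - 1)), T q0 q1 c x ∈ Set.Icc 0 (1 / (q1 - 1)) := by
    intro x hx
    obtain ⟨hx0, hx1⟩ := hx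
    unfold T
    split_ifs with h
    · constructor <;> nlinarith
    · constructor <;> nlinarith
  have hTn : ∀ n : ℕ, ∀ x ∈ Set.Icc 0 (1 / (q1 - 1)),
      (T q0 q1 c)^[n] x ∈ Set.Icc 0 (1 / (q1 - 1)) := by
    intro n
    induction n with
    | zero => intro x hx; exact hx
    | succ n ih => intro x hx; rw [Function.iterate_succ_apply]; exact ih _ (hT x hx)
  have hia : ¬ lexLt a i := fun h => hi 0 (by
    rw [shift_zero]; exact ⟨h, 0, by simp, by simp [hi0, hb]⟩)
  have hjb : ¬ lexLt j b := fun h => hj 0 (by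
    rw [shift_zero]; exact ⟨⟨0, by simp, by simp [hj0, ha]⟩, h⟩)
  intro x hx
  refine ⟨kap q0 q1 c x, ?_, kap_pi h0 h1 hT hx⟩
  rintro n ⟨hl1, hl2⟩
  rw [kap_shift] at hl1 hl2
  have hz := hTn n x hx
  generalize (T q0 q1 c)^[n] x = z at hl1 hl2 hz
  have hpz := kap_pi h0 h1 hT hz
  by_cases hzc : c ≤ z
  · have hlt2 : lexLt (kap q0 q1 c z) j := by
      by_cases he : kap q0 q1 c z = j
      · rw [he] at hl2; exact absurd hl2 hjb
      · rcases lex_tri he with h | h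
        · exact h
        · exact absurd (lex_trans h hl2) hjb
    obtain ⟨m, hme, hml⟩ := hlt2
    have hs := piE_sub h0 h1 m _ _ hme
    have hp := prod_ge_one h0 h1 (kap q0 q1 c z) m
    rw [kap_shift, kap_pi h0 h1 hT (hTn m z hz), hpz] at hs
    obtain ⟨hk, hjm⟩ : kap q0 q1 c z m = false ∧ j m = true := Bool.lt_iff.1 hml
    have hzm : (T q0 q1 c)^[m] z < c := by simpa [kap] using hk
    have := hjmin' (shiftTail j m) (omega_shift hj m) (by simpa [shiftTail] using hjm)
    rw [eq_div_iff (by linarith)] at hs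
    nlinarith
  · push Not at hzc
    have hlt2 : lexLt i (kap q0 q1 c z) := by
      by_cases he : i = kap q0 q1 c z
      · rw [← he] at hl1; exact absurd hl1 hia
      · rcases lex_tri he with h | h
        · exact h
        · exact absurd (lex_trans hl1 h) hia
    obtain ⟨m, hme, hml⟩ := hlt2
    have hs := piE_sub h0 h1 m _ _ hme
    have hp := prod_ge_one h0 h1 i m
    rw [kap_shift, kap_pi h0 h1 hT (hTn m z hz), hpz, ← hc] at hs
    obtain ⟨him, hk⟩ : i m = false ∧ kap q0 q1 c z m = true := Bool.lt_iff.1 hml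
    have hzm : c ≤ (T q0 q1 c)^[m] z := by simpa [kap] using hk
    have := himax' (shiftTail i m) (omega_shift hi m) (by simpa [shiftTail] using him)
    rw [eq_div_iff (by linarith)] at hs
    nlinarith

lemma gap_dist {a b : ℕ → Bool} {q0 q1 δ : ℝ} (h0 : 1 < q0) (h1 : 1 < q1)
    (hδ : ∀ i ∈ Omega a b, ∀ j ∈ Omega a b, i 0 = false → j 0 = true →
      δ ≤ piE q0 q1 j - piE q0 q1 i)
    {i j : ℕ → Bool} (hi : i ∈ Omega a b) (hj : j ∈ Omega a b) (n : ℕ)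
    (hn : ∀ m, m < n → i m = j m) (hne : i n ≠ j n) :
    δ / ∏ k ∈ Finset.range n, qb q0 q1 (i k) ≤ |piE q0 q1 i - piE q0 q1 j| := by
  have hp := prod_ge_one h0 h1 i n
  rw [piE_sub h0 h1 n i j hn, abs_div,
    abs_of_pos (by linarith : 0 < ∏ k ∈ Finset.range n, qb q0 q1 (i k))]
  gcongr
  have hi' := omega_shift hi n
  have hj' := omega_shift hj n
  cases h : i n
  · have h' : j n = true := by
      rw [h] at hne; cases h2 : j n <;> simp_all
    have := hδ _ hi' _ hj' (by simpa [shiftTail] using h) (by simpa [shiftTail] using h')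
    exact this.trans ((neg_sub (piE q0 q1 (shiftTail i n)) _).symm.le.trans (neg_le_abs _))
  · have h' : j n = false := by
      rw [h] at hne; cases h2 : j n <;> simp_all
    have := hδ _ hj' _ hi' (by simpa [shiftTail] using h') (by simpa [shiftTail] using h)
    exact this.trans (le_abs_self _)

lemma holder_dim {a b : ℕ → Bool} {q0 q1 p0 p1 : ℝ} (h0 : 1 < q0) (h1 : 1 < q1)
    (g0 : 1 < p0) (g1 : 1 < p1) (hgap : Gap a b q0 q1) {r : NNReal} (hr : 0 < r)
    (hp0 : q0 ^ (r : ℝ) ≤ p0) (hp1 : q1 ^ (r : ℝ) ≤ p1) :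
    r * dimH (piE p0 p1 '' Omega a b) ≤ dimH (piE q0 q1 '' Omega a b) := by
  obtain ⟨δ, hδ0, hδ⟩ := hgap
  have hinj : Set.InjOn (piE q0 q1) (Omega a b) := by
    intro i hi j hj hij
    by_contra hne
    obtain ⟨n, hn, hd⟩ := first_diff hne
    have := gap_dist h0 h1 hδ hi hj n hn hd
    rw [hij, sub_self, abs_zero] at this
    have hp := prod_ge_one h0 h1 i n
    have : 0 < δ / ∏ k ∈ Finset.range n, qb q0 q1 (i k) := by positivity
    linarith
  set f : ℝ → ℝ := fun x => piE p0 p1 (Function.invFunOn (piE q0 q1) (Omega a b) x) with hf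
  have hfe : ∀ i ∈ Omega a b, f (piE q0 q1 i) = piE p0 p1 i := by
    intro i hi
    simp only [hf]
    rw [hinj.leftInvOn_invFunOn hi]
  have himg : f '' (piE q0 q1 '' Omega a b) = piE p0 p1 '' Omega a b := by
    rw [Set.image_image]
    exact Set.image_congr hfe
  have hM : 0 < 1 / (p1 - 1) := by
    have : 0 < p1 - 1 := by linarith
    positivity
  have hprod : ∀ (i : ℕ → Bool) (n : ℕ), (∏ k ∈ Finset.range n, qb q0 q1 (i k)) ^ (r : ℝ) ≤
      ∏ k ∈ Finset.range n, qb p0 p1 (i k) := by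
    intro i n
    rw [← Real.finsetProd_rpow _ _ (fun k _ => by linarith [qb_gt h0 h1 (i k)])]
    refine Finset.prod_le_prod (fun k _ => ?_) (fun k _ => ?_)
    · have := qb_gt h0 h1 (i k)
      positivity
    · cases i k <;> simp [qb, hp0, hp1]
  obtain ⟨C, hC⟩ : ∃ C : NNReal, (C : ℝ) = (1 / (p1 - 1)) / δ ^ (r : ℝ) :=
    ⟨⟨_, by positivity⟩, rfl⟩
  have hh : HolderOnWith C r f (piE q0 q1 '' Omega a b) := by
    rintro _ ⟨i, hi, rfl⟩ _ ⟨j, hj, rfl⟩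
    rw [hfe i hi, hfe j hj]
    by_cases hij : i = j
    · simp [hij]
    obtain ⟨n, hn, hd⟩ := first_diff hij
    have h := gap_dist h0 h1 hδ hi hj n hn hd
    have hP := prod_ge_one h0 h1 i n
    have hP' := prod_ge_one g0 g1 i n
    have hreal : dist (piE p0 p1 i) (piE p0 p1 j) ≤
        C * dist (piE q0 q1 i) (piE q0 q1 j) ^ (r : ℝ) := by
      rw [Real.dist_eq, Real.dist_eq]
      have hu : |piE p0 p1 i - piE p0 p1 j| ≤
          (1 / (p1 - 1)) / ∏ k ∈ Finset.range n, qb p0 p1 (i k) := by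
        rw [piE_sub g0 g1 n i j hn, abs_div,
          abs_of_pos (by linarith : 0 < ∏ k ∈ Finset.range n, qb p0 p1 (i k))]
        gcongr
        have := piE_nonneg g0 g1 (shiftTail i n)
        have := piE_nonneg g0 g1 (shiftTail j n)
        have := piE_le g0 g1 (shiftTail i n)
        have := piE_le g0 g1 (shiftTail j n)
        rw [abs_le]; constructor <;> linarith
      have hl := Real.rpow_le_rpow (by positivity) h (NNReal.coe_nonneg r)
      rw [Real.div_rpow hδ0.le (by linarith)] at hl
      have hpos : 0 < (∏ k ∈ Finset.range n, qb q0 q1 (i k)) ^ (r : ℝ) := by positivity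
      have hδr : 0 < δ ^ (r : ℝ) := by positivity
      calc _ ≤ _ := hu
        _ ≤ (1 / (p1 - 1)) / (∏ k ∈ Finset.range n, qb q0 q1 (i k)) ^ (r : ℝ) := by
            gcongr
            exact hprod i n
        _ = C * (δ ^ (r : ℝ) / (∏ k ∈ Finset.range n, qb q0 q1 (i k)) ^ (r : ℝ)) := by
            rw [hC]; field_simp
        _ ≤ _ := by gcongr
    rw [edist_dist, edist_dist, ENNReal.ofReal_rpow_of_nonneg dist_nonneg (NNReal.coe_nonneg r),
      ← ENNReal.ofReal_coe_nnreal, ← ENNReal.ofReal_mul (NNReal.coe_nonneg C)]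
    exact ENNReal.ofReal_le_ofReal hreal
  have := hh.dimH_image_le hr
  rw [himg] at this
  rw [mul_comm]
  exact ENNReal.mul_le_of_le_div this

lemma dim_le_one (S : Set ℝ) : dimH S ≤ 1 := by
  have := dimH_mono (Set.subset_univ S)
  rwa [Real.dimH_univ] at this

lemma dim_compare (a b : ℕ → Bool) (ha : a 0 = false) (hb : b 0 = true) {q0 q1 p0 p1 : ℝ}
    (h0 : 1 < q0) (h1 : 1 < q1)
    (g0 : 1 < p0) (g1 : 1 < p1) {r : NNReal} (hr : 0 < r) (hr1 : r ≤ 1)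
    (hp0 : q0 ^ (r : ℝ) ≤ p0) (hp1 : q1 ^ (r : ℝ) ≤ p1) :
    dimH (piE p0 p1 '' Omega a b) ≤ dimH (piE q0 q1 '' Omega a b) + (1 - r : NNReal) := by
  rcases dichotomy a b ha hb h0 h1 with h | h
  · have h2 := holder_dim h0 h1 g0 g1 h hr hp0 hp1
    have e : (1 : ENNReal) = (r : ENNReal) + ((1 - r : NNReal) : ENNReal) := by
      rw [← ENNReal.coe_add, add_tsub_cancel_of_le hr1, ENNReal.coe_one]
    calc dimH (piE p0 p1 '' Omega a b) = 1 * dimH (piE p0 p1 '' Omega a b) := (one_mul _).symm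
      _ = r * dimH (piE p0 p1 '' Omega a b) + (1 - r : NNReal) * dimH (piE p0 p1 '' Omega a b) := by
          rw [← add_mul, ← e]
      _ ≤ _ := by
          refine add_le_add h2 ?_
          calc _ ≤ ((1 - r : NNReal) : ENNReal) * 1 := by gcongr; exact dim_le_one _
            _ = _ := mul_one _
  · have hpos : 0 < 1 / (q1 - 1) := by
      have : 0 < q1 - 1 := by linarith
      positivity
    have h2 : dimH (Set.Icc 0 (1 / (q1 - 1))) = 1 := by
      rw [Real.dimH_of_nonempty_interior, Module.finrank_self]
      · simp
      · rw [interior_Icc]; exact Set.nonempty_Ioo.2 hpos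
    have h3 := dimH_mono h
    rw [h2] at h3
    exact ((dim_le_one _).trans h3).trans le_self_add

end S19

/-- Lemma: for fixed `a ∈ 0{0,1}^ℕ`, `b ∈ 1{0,1}^ℕ`, the map
`(q₀,q₁) ↦ dim_H π_{q₀,q₁}(Ω_{a,b})` is continuous on `(1,∞) × (1,∞)`. -/
theorem stmt19 (a b : ℕ → Bool) (ha : a 0 = false) (hb : b 0 = true) :
    ContinuousOn (fun p : ℝ × ℝ => dimH (piE p.1 p.2 '' Omega a b))
      (Set.Ioi (1 : ℝ) ×ˢ Set.Ioi (1 : ℝ)) := by 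
  rintro ⟨q0, q1⟩ ⟨h0, h1⟩
  simp only [Set.mem_Ioi] at h0 h1
  unfold ContinuousWithinAt
  rw [ENNReal.tendsto_nhds (ne_top_of_le_ne_top ENNReal.one_ne_top (S19.dim_le_one _))]
  intro ε hε
  obtain ⟨r, hr0, hr1, hrε⟩ : ∃ r : NNReal, 0 < r ∧ r < 1 ∧ ((1 - r : NNReal) : ENNReal) ≤ ε := by
    obtain ⟨e, he0, he⟩ := ENNReal.lt_iff_exists_nnreal_btwn.1 hε
    have he0' : 0 < e := by exact_mod_cast he0
    have hm : 0 < min e (1 / 2) := lt_min he0' (by norm_num)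
    have hm1 : min e (1 / 2) < 1 := lt_of_le_of_lt (min_le_right _ _) (by
      rw [← NNReal.coe_lt_coe]; norm_num)
    refine ⟨1 - min e (1 / 2), tsub_pos_of_lt hm1, tsub_lt_self one_pos hm, ?_⟩
    rw [tsub_tsub_cancel_of_le hm1.le]
    refine le_trans ?_ he.le
    exact_mod_cast min_le_left _ _
  have hr1' : (r : ℝ) < 1 := by exact_mod_cast hr1
  have key : ∀ q : ℝ, 1 < q → ∀ᶠ p in 𝓝 q, q ^ (r : ℝ) ≤ p ∧ p ^ (r : ℝ) ≤ q := by
    intro q hq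
    have hlt : q ^ (r : ℝ) < q := by
      simpa using Real.rpow_lt_rpow_of_exponent_lt hq hr1'
    have hc : ContinuousAt (fun p : ℝ => p ^ (r : ℝ)) q :=
      Real.continuousAt_rpow_const _ _ (Or.inl (by linarith))
    filter_upwards [eventually_gt_nhds hlt, hc.eventually_lt_const hlt] with p h h'
    exact ⟨h.le, h'.le⟩
  have k0 := (continuous_fst.tendsto (q0, q1)).eventually (key q0 h0)
  have k1 := (continuous_snd.tendsto (q0, q1)).eventually (key q1 h1)
  filter_upwards [self_mem_nhdsWithin, nhdsWithin_le_nhds k0, nhdsWithin_le_nhds k1]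
    with p hp hp0 hp1
  have g0 : 1 < p.1 := hp.1
  have g1 : 1 < p.2 := hp.2
  constructor
  · rw [tsub_le_iff_right]
    refine (S19.dim_compare a b ha hb g0 g1 h0 h1 hr0 hr1.le hp0.2 hp1.2).trans ?_
    gcongr
  · refine (S19.dim_compare a b ha hb h0 h1 g0 g1 hr0 hr1.le hp0.1 hp1.1).trans ?_
    gcongr
end
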